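/- arXiv:2202.12158 — 2 statements merged into one kernel-verified Lean document; each statement's English description precedes it below -/
import Mathlib

section
/- The unscented transform is exact for quadratic functions: if q(x) = xᵀQx + bᵀx + d with Q ∈ ℝ^{n×n}, b ∈ ℝⁿ, d ∈ ℝ, and S·Sᵀ = (n+κ)·P, then the weighted sum of q over the sigma points equals the value of q at the mean plus the trace correction: ∑_{i=0}^{2n} c⁽ⁱ⁾ q(𝒳⁽ⁱ⁾) = q(x̄) + trace(Q·P). In particular, for q(u) = ‖u‖², the unscented estimate of the expected squared norm equals ‖x̄‖² + trace(P). -/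
open Matrix

/-- The `j`-th column of a square matrix, as a vector (zero if `j` out of range). -/
noncomputable def col {n : ℕ} (S : Matrix (Fin n) (Fin n) ℝ) (j : ℕ) : Fin n → ℝ :=
  fun r => if h : j < n then S r ⟨j, h⟩ else 0

/-- Sigma points of the unscented transform. -/
noncomputable def sigmaPt {n : ℕ} (xbar : Fin n → ℝ) (S : Matrix (Fin n) (Fin n) ℝ)
    (i : ℕ) : Fin n → ℝ :=
  if i = 0 then xbar else if i ≤ n then xbar + col S (i - 1) else xbar - col S (i - 1 - n)

/-- Unscented-transform weights. -/
noncomputable def sigmaWt (n : ℕ) (κ : ℝ) (i : ℕ) : ℝ :=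
  if i = 0 then κ / ((n : ℝ) + κ) else 1 / (2 * ((n : ℝ) + κ))

theorem ut_aux {n : ℕ} (κ : ℝ) (hκ : 0 < κ)
    (xbar : Fin n → ℝ) (S P : Matrix (Fin n) (Fin n) ℝ)
    (hS : S * S.transpose = ((n : ℝ) + κ) • P)
    (Q : Matrix (Fin n) (Fin n) ℝ) (b : Fin n → ℝ) (d : ℝ)
    (q : (Fin n → ℝ) → ℝ)
    (hq : ∀ x, q x = x ⬝ᵥ Q.mulVec x + b ⬝ᵥ x + d) :
    (∑ i ∈ Finset.range (2 * n + 1), sigmaWt n κ i * q (sigmaPt xbar S i)) =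
      q xbar + (Q * P).trace := by
  have hpos : (0 : ℝ) < (n : ℝ) + κ := by positivity
  have htr : ∑ j ∈ Finset.range n, (col S j ⬝ᵥ Q.mulVec (col S j)) =
      ((n : ℝ) + κ) * (Q * P).trace := by
    have h1 : (Q * (S * S.transpose)).trace = ((n : ℝ) + κ) * (Q * P).trace := by
      rw [hS, Matrix.mul_smul, Matrix.trace_smul, smul_eq_mul]
    rw [← h1, ← Matrix.mul_assoc, Matrix.trace_mul_comm, Finset.sum_range]
    have hc : ∀ j : Fin n, col S (j : ℕ) = fun r => S r j := by
      intro j; funext r; simp [_root_.col]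
    simp only [hc, Matrix.trace, Matrix.diag, Matrix.mul_apply, dotProduct, Matrix.mulVec,
      Matrix.transpose_apply]
  have hpair : ∀ v : Fin n → ℝ, q (xbar + v) + q (xbar - v) =
      2 * q xbar + 2 * (v ⬝ᵥ Q.mulVec v) := by
    intro v
    simp only [hq, Matrix.mulVec_add, Matrix.mulVec_sub, add_dotProduct, sub_dotProduct,
      dotProduct_add, dotProduct_sub]
    ring
  rw [Finset.sum_range_succ', two_mul, Finset.sum_range_add, ← Finset.sum_add_distrib]
  have hterm : ∀ j ∈ Finset.range n,
      sigmaWt n κ (j + 1) * q (sigmaPt xbar S (j + 1)) +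
        sigmaWt n κ (n + j + 1) * q (sigmaPt xbar S (n + j + 1)) =
      1 / ((n : ℝ) + κ) * (q xbar + (col S j ⬝ᵥ Q.mulVec (col S j))) := by
    intro j hj
    have hj' : j + 1 ≤ n := Finset.mem_range.mp hj
    have h2 : ¬ (n + j + 1 ≤ n) := by omega
    have h3 : n + j + 1 - 1 - n = j := by omega
    have e1 : sigmaPt xbar S (j + 1) = xbar + col S j := by
      simp [sigmaPt, hj']
    have e2 : sigmaPt xbar S (n + j + 1) = xbar - col S j := by
      unfold sigmaPt
      rw [if_neg (by omega), if_neg h2, h3]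
    have w1 : ∀ k, sigmaWt n κ (k + 1) = 1 / (2 * ((n : ℝ) + κ)) := by
      intro k; simp [sigmaWt]
    rw [e1, e2, w1, w1, ← mul_add, hpair]
    field_simp
  rw [Finset.sum_congr rfl hterm, ← Finset.mul_sum, Finset.sum_add_distrib, htr]
  simp only [sigmaWt, sigmaPt, if_true, Finset.sum_const, Finset.card_range, nsmul_eq_mul]
  field_simp
  ring

/-- The unscented transform is exact for quadratic functions
`q(x) = xᵀQx + bᵀx + d`: the weighted sum of `q` over the sigma points equals
`q(x̄) + trace(Q·P)`.  In particular, for `q(u) = ‖u‖²` the unscented estimate of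
the expected squared norm equals `‖x̄‖² + trace(P)`. -/
theorem unscented_exact_quadratic {n : ℕ} (hn : 1 ≤ n) (κ : ℝ) (hκ : 0 < κ)
    (xbar : Fin n → ℝ) (S P : Matrix (Fin n) (Fin n) ℝ)
    (hS : S * S.transpose = ((n : ℝ) + κ) • P)
    (Q : Matrix (Fin n) (Fin n) ℝ) (b : Fin n → ℝ) (d : ℝ)
    (q : (Fin n → ℝ) → ℝ)
    (hq : ∀ x, q x = x ⬝ᵥ Q.mulVec x + b ⬝ᵥ x + d) :
    (∑ i ∈ Finset.range (2 * n + 1), sigmaWt n κ i * q (sigmaPt xbar S i)) =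
      q xbar + (Q * P).trace ∧
    (∑ i ∈ Finset.range (2 * n + 1),
        sigmaWt n κ i * (sigmaPt xbar S i ⬝ᵥ sigmaPt xbar S i)) =
      xbar ⬝ᵥ xbar + P.trace := by
  refine ⟨ut_aux κ hκ xbar S P hS Q b d q hq, ?_⟩
  have h := ut_aux κ hκ xbar S P hS 1 0 0 (fun x => x ⬝ᵥ x) (by intro x; simp)
  simpa using h
end

section
/- Under linear dynamics with an affine feedback policy, the unscented propagation formulas yield the exact linear-Gaussian mean and covariance update: let the dynamics be f(x,u,w) = A·x + B·u + w with A ∈ ℝ^{n×n}, B ∈ ℝ^{n×m}, let the control sigma points be given by the affine policy 𝒰⁽ⁱ⁾ = K·𝒳⁽ⁱ⁾ + d with K ∈ ℝ^{m×n}, d ∈ ℝᵐ, and suppose S·Sᵀ = (n+κ_x)·P. Then the double-weighted mean estimate equals x̄⁺ := ∑_{i,j} c_x⁽ⁱ⁾ c_w⁽ʲ⁾ (A·𝒳⁽ⁱ⁾ + B·𝒰⁽ⁱ⁾ + 𝒲⁽ʲ⁾) = (A + B·K)·x̄ + B·d, and the double-weighted covariance estimate equals ∑_{i,j} c_x⁽ⁱ⁾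 c_w⁽ʲ⁾ (A·𝒳⁽ⁱ⁾ + B·𝒰⁽ⁱ⁾ + 𝒲⁽ʲ⁾ − x̄⁺)(A·𝒳⁽ⁱ⁾ + B·𝒰⁽ⁱ⁾ + 𝒲⁽ʲ⁾ − x̄⁺)ᵀ = (A + B·K)·P·(A + B·K)ᵀ + R, where R := ∑_{j} c_w⁽ʲ⁾ 𝒲⁽ʲ⁾(𝒲⁽ʲ⁾)ᵀ. -/
/-- Uncertainty sigma points: `𝒲⁽⁰⁾ = 0`, `𝒲⁽ʲ⁾ = tⱼ`, `𝒲⁽ⁿ⁺ʲ⁾ = −tⱼ`. -/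
noncomputable def wSigmaPt {n : ℕ} (T : Matrix (Fin n) (Fin n) ℝ) (j : ℕ) : Fin n → ℝ :=
  if j = 0 then 0 else if j ≤ n then col T (j - 1) else -(col T (j - 1 - n))

lemma sum_split (n : ℕ) (f : ℕ → ℝ) :
    ∑ i ∈ Finset.range (2 * n + 1), f i
      = f 0 + ∑ j : Fin n, (f (j + 1) + f (n + j + 1)) := by
  rw [Finset.sum_range_succ', two_mul, Finset.sum_range_add, Finset.sum_add_distrib,
    Finset.sum_range, Finset.sum_range]
  ring

lemma sigmaPt_eq {n : ℕ} (xbar : Fin n → ℝ) (S : Matrix (Fin n) (Fin n) ℝ) (i : ℕ) :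
    sigmaPt xbar S i = xbar + wSigmaPt S i := by
  unfold sigmaPt wSigmaPt
  split_ifs <;> simp [sub_eq_add_neg]

lemma w_zero {n : ℕ} (S : Matrix (Fin n) (Fin n) ℝ) (r : Fin n) : wSigmaPt S 0 r = 0 := by
  simp [wSigmaPt]

lemma w_pos {n : ℕ} (S : Matrix (Fin n) (Fin n) ℝ) (j r : Fin n) :
    wSigmaPt S (j + 1) r = S r j := by
  have := j.2
  simp [wSigmaPt, col]

lemma w_neg {n : ℕ} (S : Matrix (Fin n) (Fin n) ℝ) (j r : Fin n) :
    wSigmaPt S (n + j + 1) r = - S r j := by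
  have h : ¬ (n + (j : ℕ) + 1 ≤ n) := by omega
  have h2 : n + (j : ℕ) + 1 - 1 - n = j := by omega
  simp only [wSigmaPt, h, h2, if_false]
  simp [col]

lemma wt_sum (n : ℕ) (κ : ℝ) (hκ : 0 < κ) :
    ∑ i ∈ Finset.range (2 * n + 1), sigmaWt n κ i = 1 := by
  have : (n : ℝ) + κ ≠ 0 := by positivity
  rw [sum_split]
  simp [sigmaWt]
  field_simp
  ring

lemma wt_mean {n : ℕ} (κ : ℝ) (S : Matrix (Fin n) (Fin n) ℝ) (r : Fin n) :
    ∑ i ∈ Finset.range (2 * n + 1), sigmaWt n κ i * wSigmaPt S i r = 0 := by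
  rw [sum_split]
  simp only [w_zero, w_pos, w_neg]
  simp [sigmaWt]

lemma wt_cov {n : ℕ} (κ : ℝ) (hκ : 0 < κ) (S : Matrix (Fin n) (Fin n) ℝ) :
    ∑ i ∈ Finset.range (2 * n + 1),
      sigmaWt n κ i • Matrix.vecMulVec (wSigmaPt S i) (wSigmaPt S i)
      = ((n : ℝ) + κ)⁻¹ • (S * S.transpose) := by
  have : (n : ℝ) + κ ≠ 0 := by positivity
  ext r s
  simp only [Matrix.sum_apply, Matrix.smul_apply, Matrix.vecMulVec_apply, smul_eq_mul]
  rw [sum_split]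
  simp only [w_zero, w_pos, w_neg, Matrix.mul_apply, Matrix.transpose_apply, Finset.mul_sum]
  simp only [mul_zero, zero_add]
  refine Finset.sum_congr rfl fun j _ => ?_
  simp [sigmaWt]
  field_simp
  ring

lemma double_sum (I : Finset ℕ) (a b p q p' q' : ℕ → ℝ)
    (ha : ∑ i ∈ I, a i = 1) (hb : ∑ i ∈ I, b i = 1)
    (hp : ∑ i ∈ I, a i * p i = 0) (hp' : ∑ i ∈ I, a i * p' i = 0) :
    ∑ i ∈ I, ∑ j ∈ I, (a i * b j) * ((p i + q j) * (p' i + q' j))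
      = ∑ i ∈ I, a i * (p i * p' i) + ∑ j ∈ I, b j * (q j * q' j) := by
  have : ∀ i j, (a i * b j) * ((p i + q j) * (p' i + q' j)) =
      (a i * (p i * p' i)) * b j + (a i * p i) * (b j * q' j) + (a i * p' i) * (b j * q j)
        + a i * (b j * (q j * q' j)) := by intros; ring
  simp only [this, Finset.sum_add_distrib, ← Finset.mul_sum, ← Finset.sum_mul, ha, hb, hp, hp']
  ring

/-- Under linear dynamics `f(x,u,w) = A·x + B·u + w` with affine feedback
`𝒰⁽ⁱ⁾ = K·𝒳⁽ⁱ⁾ + d` and `S·Sᵀ = (n+κ_x)·P`, the unscented propagation formulas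
yield the exact linear-Gaussian mean and covariance update:
mean `(A + B·K)·x̄ + B·d` and covariance `(A + B·K)·P·(A + B·K)ᵀ + R`. -/
theorem unscented_linear_feedback_exact {n m : ℕ} (hn : 1 ≤ n)
    (κx κw : ℝ) (hκx : 0 < κx) (hκw : 0 < κw)
    (xbar : Fin n → ℝ) (S P : Matrix (Fin n) (Fin n) ℝ) (T : Matrix (Fin n) (Fin n) ℝ)
    (hS : S * S.transpose = ((n : ℝ) + κx) • P)
    (A : Matrix (Fin n) (Fin n) ℝ) (B : Matrix (Fin n) (Fin m) ℝ)
    (K : Matrix (Fin m) (Fin n) ℝ) (d : Fin m → ℝ)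
    (U : ℕ → Fin m → ℝ) (hU : ∀ i, U i = K.mulVec (sigmaPt xbar S i) + d)
    (R : Matrix (Fin n) (Fin n) ℝ)
    (hR : R = ∑ j ∈ Finset.range (2 * n + 1),
        sigmaWt n κw j • Matrix.vecMulVec (wSigmaPt T j) (wSigmaPt T j))
    (xplus : Fin n → ℝ)
    (hxplus : xplus = ∑ i ∈ Finset.range (2 * n + 1), ∑ j ∈ Finset.range (2 * n + 1),
        (sigmaWt n κx i * sigmaWt n κw j) •
          (A.mulVec (sigmaPt xbar S i) + B.mulVec (U i) + wSigmaPt T j)) :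
    xplus = (A + B * K).mulVec xbar + B.mulVec d ∧
    (∑ i ∈ Finset.range (2 * n + 1), ∑ j ∈ Finset.range (2 * n + 1),
        (sigmaWt n κx i * sigmaWt n κw j) •
          Matrix.vecMulVec
            (A.mulVec (sigmaPt xbar S i) + B.mulVec (U i) + wSigmaPt T j - xplus)
            (A.mulVec (sigmaPt xbar S i) + B.mulVec (U i) + wSigmaPt T j - xplus)) =
      (A + B * K) * P * (A + B * K).transpose + R := by
  have hM : ∀ i, A.mulVec (sigmaPt xbar S i) + B.mulVec (U i)
      = ((A + B * K).mulVec xbar + B.mulVec d) + (A + B * K).mulVec (wSigmaPt S i) := by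
    intro i
    rw [hU, sigmaPt_eq]
    simp only [Matrix.mulVec_add, Matrix.add_mulVec, Matrix.mulVec_mulVec]
    abel
  simp only [hM] at hxplus ⊢
  generalize A + B * K = M at *
  generalize M.mulVec xbar + B.mulVec d = c at *
  have hp : ∀ r, ∑ i ∈ Finset.range (2 * n + 1),
      sigmaWt n κx i * M.mulVec (wSigmaPt S i) r = 0 := by
    intro r
    simp only [Matrix.mulVec, dotProduct, Finset.mul_sum]
    rw [Finset.sum_comm]
    refine Finset.sum_eq_zero fun k _ => ?_
    have h := wt_mean κx S k
    calc _ = M r k * ∑ i ∈ Finset.range (2 * n + 1), sigmaWt n κx i * wSigmaPt S i k := by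
          rw [Finset.mul_sum]
          exact Finset.sum_congr rfl fun _ _ => by ring
      _ = 0 := by rw [h, mul_zero]
  have hx : xplus = c := by
    rw [hxplus]
    ext r
    simp only [Finset.sum_apply, Pi.smul_apply, Pi.add_apply, smul_eq_mul]
    have : ∀ i j, sigmaWt n κx i * sigmaWt n κw j *
        (c r + M.mulVec (wSigmaPt S i) r + wSigmaPt T j r)
        = sigmaWt n κx i * (sigmaWt n κw j * c r)
          + (sigmaWt n κx i * M.mulVec (wSigmaPt S i) r) * sigmaWt n κw j
          + sigmaWt n κx i * (sigmaWt n κw j * wSigmaPt T j r) := by intros; ring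
    simp only [this, Finset.sum_add_distrib, ← Finset.mul_sum, ← Finset.sum_mul,
      wt_sum n κx hκx, wt_sum n κw hκw, wt_mean, hp]
    ring
  refine ⟨hx, ?_⟩
  rw [hx]
  have hne : (n : ℝ) + κx ≠ 0 := by positivity
  have hP : P = ∑ i ∈ Finset.range (2 * n + 1),
      sigmaWt n κx i • Matrix.vecMulVec (wSigmaPt S i) (wSigmaPt S i) := by
    rw [wt_cov κx hκx, hS, inv_smul_smul₀ hne]
  have hMP : M * P * M.transpose = ∑ i ∈ Finset.range (2 * n + 1),
      sigmaWt n κx i • Matrix.vecMulVec (M.mulVec (wSigmaPt S i)) (M.mulVec (wSigmaPt S i)) := by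
    rw [hP, Matrix.mul_sum, Matrix.sum_mul]
    refine Finset.sum_congr rfl fun i _ => ?_
    rw [Matrix.mul_smul, Matrix.smul_mul, Matrix.mul_vecMulVec, Matrix.vecMulVec_mul,
      Matrix.vecMul_transpose]
  rw [hMP, hR]
  ext r s
  simp only [Matrix.add_apply, Matrix.sum_apply, Matrix.smul_apply, Matrix.vecMulVec_apply,
    smul_eq_mul, Pi.sub_apply, Pi.add_apply]
  rw [← double_sum _ _ _ _ _ _ _ (wt_sum n κx hκx) (wt_sum n κw hκw) (hp r) (hp s)]
  refine Finset.sum_congr rfl fun i _ => Finset.sum_congr rfl fun j _ => ?_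
  ring
end
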